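/- Suppose the chain is recurrent and there exist a finite set A ⊆ 𝕏 and a constant C > 0 such that E_x(τ_A) ≤ C for all x ∈ 𝕏. Then the chain implodes towards every state: for every z ∈ 𝕏 there exists a constant C' > 0 such that E_x(τ_{{z}}) ≤ C' for all x ∈ 𝕏. -/

import Mathlib

open MeasureTheory Set Filter
open scoped Classical ENNReal NNReal

/-- A continuous-time Markov chain on a countably infinite state space `X`,
described by its generator `Γ`, together with a probability space carrying,
for each starting point `x`, the embedded jump chain `jump` and the holding
times `hold` (with `hold n` the holding time at the `n`-th visited state). -/
structure CTMC where
  X : Type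
  countX : Countable X
  infX : Infinite X
  Γ : X → X → ℝ
  γ : X → ℝ
  γ_pos : ∀ x, 0 < γ x
  Γ_offdiag_nonneg : ∀ x y, y ≠ x → 0 ≤ Γ x y
  Γ_diag : ∀ x, Γ x x = - γ x
  γ_sum : ∀ x, HasSum (fun y => if y = x then 0 else Γ x y) (γ x)
  /-- irreducibility of the embedded jump chain -/
  irr : ∀ x y : X, ∃ (n : ℕ) (path : ℕ → X), path 0 = x ∧ path n = y ∧
    ∀ k, k < n → 0 < (if path (k+1) = path k then 0
      else Γ (path k) (path (k+1)) / γ (path k))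
  Ω : Type
  measΩ : MeasurableSpace Ω
  μ : X → @Measure Ω measΩ
  probμ : ∀ x, @IsProbabilityMeasure Ω measΩ (μ x)
  jump : ℕ → Ω → X
  hold : ℕ → Ω → ℝ
  jump_meas : ∀ (n : ℕ) (x : X), MeasurableSet[measΩ] {ω | jump n ω = x}
  hold_meas : ∀ n : ℕ, @Measurable Ω ℝ measΩ _ (hold n)
  hold_pos : ∀ n ω, 0 < hold n ω
  /-- under `μ x` the chain starts at `x` -/
  start : ∀ x : X, μ x {ω | jump 0 ω = x} = 1
  /-- finite-dimensional law: the embedded chain is Markov with transition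
  probabilities `P x y = Γ x y / γ x` (for `y ≠ x`), and conditionally on the
  embedded chain the holding times are independent exponentials of rates
  `γ (jump n)` -/
  law : ∀ (x : X) (n : ℕ) (path : ℕ → X) (t : ℕ → ℝ), path 0 = x → (∀ k, 0 ≤ t k) →
    μ x {ω | (∀ k, k ≤ n → jump k ω = path k) ∧ (∀ k, k < n → t k < hold k ω)}
      = ENNReal.ofReal (∏ k ∈ Finset.range n,
          ((if path (k+1) = path k then 0 else Γ (path k) (path (k+1)) / γ (path k))
            * Real.exp (-(γ (path k)) * t k)))

namespace CTMC

attribute [instance] CTMC.countX CTMC.infX CTMC.measΩ CTMC.probμ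

variable (M : CTMC)

/-- embedded chain transition probabilities -/
noncomputable def P (x y : M.X) : ℝ := if y = x then 0 else M.Γ x y / M.γ x

/-- jump times -/
noncomputable def J (n : ℕ) (ω : M.Ω) : ℝ := ∑ k ∈ Finset.range n, M.hold k ω

/-- explosion (life) time -/
noncomputable def zeta (ω : M.Ω) : ℝ≥0∞ := ⨆ n, ENNReal.ofReal (M.J n ω)

/-- the continuous-time chain: `pos t ω = some (jump n ω)` if `J n ≤ t < J (n+1)`,
and `none` (the cemetery state `∂`) after the explosion time. -/
noncomputable def pos (t : ℝ) (ω : M.Ω) : Option M.X :=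
  if h : ∃ n, M.J n ω ≤ t ∧ t < M.J (n+1) ω then some (M.jump h.choose ω) else none

/-- passage time: `τ_A = inf {t ≥ 0 : ξ_t ∈ A}` -/
noncomputable def tau (A : Set M.X) (ω : M.Ω) : ℝ≥0∞ :=
  sInf (ENNReal.ofReal '' {s : ℝ | 0 ≤ s ∧ ∃ a ∈ A, M.pos s ω = some a})

/-- `f` belongs to the domain of the generator -/
def InDom (f : M.X → ℝ) : Prop :=
  ∀ x : M.X, Summable (fun y => if y = x then 0 else M.Γ x y * f y)

/-- `f ∈ Dom_+(Γ)` -/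
def InDomPos (f : M.X → ℝ) : Prop := (∀ x, 0 ≤ f x) ∧ M.InDom f

/-- action of the generator : `Γ f (x) = ∑_y Γ_{xy} f(y)` -/
noncomputable def gen (f : M.X → ℝ) (x : M.X) : ℝ :=
  (∑' y, if y = x then 0 else M.Γ x y * f y) - M.γ x * f x

/-- recurrence of the embedded jump chain -/
def JumpRecurrent : Prop := ∀ x : M.X, M.μ x {ω | ∃ n, 1 ≤ n ∧ M.jump n ω = x} = 1

/-- `f → ∞` : all sublevel sets are finite -/
def FinSublevels (f : M.X → ℝ) : Prop := ∀ r : ℝ, {x : M.X | f x ≤ r}.Finite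

end CTMC

namespace CTMC

variable (M : CTMC)

/-- transition probabilities in `ℝ≥0∞` -/
noncomputable def pe (x y : M.X) : ℝ≥0∞ := ENNReal.ofReal (M.P x y)

/-- killed transition operator -/
noncomputable def KB (B : Set M.X) (f : M.X → ℝ≥0∞) (x : M.X) : ℝ≥0∞ :=
  if x ∈ B then 0 else ∑' y, M.pe x y * f y

/-- truncation of a function off `B` -/
noncomputable def off (B : Set M.X) (w : M.X → ℝ≥0∞) (x : M.X) : ℝ≥0∞ :=
  if x ∈ B then 0 else w x

/-- truncated Green potential -/
noncomputable def vv (B : Set M.X) (w : M.X → ℝ≥0∞) (m : ℕ) (x : M.X) : ℝ≥0∞ :=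
  ∑ k ∈ Finset.range m, (M.KB B)^[k] (M.off B w) x

/-- mean holding times -/
noncomputable def we (x : M.X) : ℝ≥0∞ := ENNReal.ofReal (1 / M.γ x)

lemma P_nonneg (x y : M.X) : 0 ≤ M.P x y := by
  unfold P
  split_ifs with h
  · exact le_rfl
  · exact div_nonneg (M.Γ_offdiag_nonneg x y h) (M.γ_pos x).le

lemma pe_sum (x : M.X) : ∑' y, M.pe x y = 1 := by
  have h : HasSum (fun y => M.P x y) 1 := by
    have := (M.γ_sum x).div_const (M.γ x)
    rw [div_self (M.γ_pos x).ne'] at this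
    have e : (fun y => M.P x y) = fun y => (if y = x then 0 else M.Γ x y) / M.γ x := by
      funext y
      unfold P
      split_ifs <;> simp
    rw [e]
    exact this
  unfold pe
  rw [← ENNReal.ofReal_tsum_of_nonneg (M.P_nonneg x) h.summable, h.tsum_eq]
  simp

lemma KB_mono (B : Set M.X) {f g : M.X → ℝ≥0∞} (h : ∀ x, f x ≤ g x) (x : M.X) :
    M.KB B f x ≤ M.KB B g x := by
  unfold KB
  split_ifs
  · exact le_rfl
  · exact ENNReal.tsum_le_tsum fun y => by gcongr; exact h y

lemma pe_const (x : M.X) (c : ℝ≥0∞) : ∑' y, M.pe x y * c = c := by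
  rw [ENNReal.tsum_mul_right, M.pe_sum, one_mul]

lemma KB_const (B : Set M.X) (c : ℝ≥0∞) (x : M.X) : M.KB B (fun _ => c) x ≤ c := by
  unfold KB
  split_ifs
  · exact zero_le
  · rw [M.pe_const]

lemma KB_le_const (B : Set M.X) {f : M.X → ℝ≥0∞} {c : ℝ≥0∞} (h : ∀ x, f x ≤ c) (x : M.X) :
    M.KB B f x ≤ c :=
  (M.KB_mono B h x).trans (M.KB_const B c x)

lemma iter_le_const (B : Set M.X) {f : M.X → ℝ≥0∞} {c : ℝ≥0∞} (h : ∀ x, f x ≤ c) (k : ℕ) :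
    ∀ x, (M.KB B)^[k] f x ≤ c := by
  induction k with
  | zero => simpa using h
  | succ k ih =>
    intro x
    rw [Function.iterate_succ_apply']
    exact M.KB_le_const B ih x

lemma vv_le (B : Set M.X) {w : M.X → ℝ≥0∞} {W : ℝ≥0∞} (h : ∀ x, w x ≤ W) (m : ℕ) (x : M.X) :
    M.vv B w m x ≤ m * W := by
  unfold vv
  calc _ ≤ ∑ k ∈ Finset.range m, W := by
        refine Finset.sum_le_sum fun k _ => M.iter_le_const B ?_ k x
        intro x
        unfold off
        split_ifs
        · exact zero_le
        · exact h x
    _ = m * W := by simp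

lemma KB_sum (B : Set M.X) (m : ℕ) (f : ℕ → M.X → ℝ≥0∞) (x : M.X) :
    M.KB B (fun y => ∑ k ∈ Finset.range m, f k y) x
      = ∑ k ∈ Finset.range m, M.KB B (f k) x := by
  unfold KB
  split_ifs
  · simp
  · simp_rw [Finset.mul_sum]
    rw [Summable.tsum_finsetSum]
    intro i _
    exact ENNReal.summable

lemma vv_succ (B : Set M.X) (w : M.X → ℝ≥0∞) (m : ℕ) (x : M.X) :
    M.vv B w (m+1) x = M.off B w x + M.KB B (M.vv B w m) x := by
  have : M.vv B w m = fun y => ∑ k ∈ Finset.range m, (M.KB B)^[k] (M.off B w) y := rfl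
  rw [this, M.KB_sum]
  unfold vv
  rw [Finset.sum_range_succ', add_comm]
  simp [Function.iterate_succ_apply']

lemma vv_mono (B : Set M.X) (w : M.X → ℝ≥0∞) (x : M.X) : Monotone fun m => M.vv B w m x := by
  intro m n h
  exact Finset.sum_le_sum_of_subset (Finset.range_mono h)

lemma one_antitone (B : Set M.X) (x : M.X) : Antitone fun m => (M.KB B)^[m] (fun _ => 1) x := by
  have key : ∀ m, ∀ x, (M.KB B)^[m+1] (fun _ => 1) x ≤ (M.KB B)^[m] (fun _ => 1) x := by
    intro m
    induction m with
    | zero => intro x; simpa using M.KB_const B 1 x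
    | succ m ih =>
      intro x
      rw [Function.iterate_succ_apply' _ (m+1)]
      conv_rhs => rw [Function.iterate_succ_apply' _ m]
      exact M.KB_mono B ih x
  exact antitone_nat_of_succ_le fun m => key m x

/-- comparison lemma for sub-harmonic functions -/
lemma sub_le (B : Set M.X) {V w : M.X → ℝ≥0∞} {S c : ℝ≥0∞}
    (hV : ∀ x, V x ≤ w x + ∑' y, M.pe x y * V y) (hS : ∀ x, V x ≤ S)
    (hc : ∀ x ∈ B, V x ≤ c) (j : ℕ) :
    ∀ x, V x ≤ c + M.vv B w j x + S * (M.KB B)^[j] (fun _ => 1) x := by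
  induction j with
  | zero => intro x; simpa using (hS x).trans le_add_self
  | succ j ih =>
    intro x
    by_cases hx : x ∈ B
    · exact (hc x hx).trans (by rw [add_assoc]; exact le_self_add)
    · rw [vv_succ, Function.iterate_succ_apply']
      simp only [off, KB, hx, if_false]
      calc V x ≤ w x + ∑' y, M.pe x y * V y := hV x
        _ ≤ w x + ∑' y, (M.pe x y * c + M.pe x y * M.vv B w j y
              + S * (M.pe x y * (M.KB B)^[j] (fun _ => 1) y)) := by
            gcongr with y
            calc _ ≤ M.pe x y * (c + M.vv B w j y + S * (M.KB B)^[j] (fun _ => 1) y) := by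
                  gcongr; exact ih y
              _ = _ := by ring
        _ = _ := by
            rw [ENNReal.tsum_add, ENNReal.tsum_add, M.pe_const, ENNReal.tsum_mul_left]
            ring

lemma core (A : Set M.X) (z : M.X) {V w : M.X → ℝ≥0∞} {W C θ : ℝ≥0∞} {n : ℕ}
    (hV : ∀ x, V x ≤ w x + ∑' y, M.pe x y * V y) (hz : V z = 0) (hw : ∀ x, w x ≤ W)
    (hC : ∀ j x, M.vv A w j x ≤ C)
    (hA : ∀ x, Tendsto (fun j => (M.KB A)^[j] (fun _ => 1) x) atTop (nhds 0))
    (hθ : ∀ a ∈ A, (M.KB {z})^[n] (fun _ => 1) a ≤ θ) (hθ1 : θ < 1)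
    (hS : ⨆ x, V x ≠ ⊤) (x : M.X) : V x ≤ (n * W + C) / (1 - θ) := by
  set S := ⨆ x, V x with hSdef
  have hVS : ∀ x, V x ≤ S := fun x => le_iSup V x
  have h1 : ∀ a ∈ A, V a ≤ n * W + S * θ := by
    intro a ha
    have := M.sub_le {z} (c := 0) hV hVS (by rintro x rfl; exact hz.le) n a
    rw [zero_add] at this
    refine this.trans ?_
    gcongr
    · exact M.vv_le _ hw n a
    · exact hθ a ha
  have h2 : ∀ x, V x ≤ (n * W + S * θ) + C := by
    intro x
    have ht : Tendsto (fun j => (n * W + S * θ) + C + S * (M.KB A)^[j] (fun _ => 1) x)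
        atTop (nhds ((n * W + S * θ) + C + S * 0)) := by
      refine Tendsto.add tendsto_const_nhds ?_
      exact ENNReal.Tendsto.const_mul (hA x) (Or.inr hS)
    rw [mul_zero, add_zero] at ht
    refine ge_of_tendsto' ht fun j => ?_
    refine (M.sub_le A hV hVS h1 j x).trans ?_
    gcongr
    exact hC j x
  have h3 : S ≤ (n * W + C) + S * θ := by
    refine iSup_le fun x => (h2 x).trans (le_of_eq (by ring))
  have h4 : S ≤ (n * W + C) / (1 - θ) := by
    rw [ENNReal.le_div_iff_mul_le (Or.inl (tsub_pos_of_lt hθ1).ne')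
      (Or.inl (ENNReal.sub_ne_top ENNReal.one_ne_top))]
    rw [ENNReal.mul_sub (fun _ _ => hS), mul_one]
    exact tsub_le_iff_right.2 h3
  exact (hVS x).trans h4

lemma hit_pos (z : M.X) (n : ℕ) : ∀ (path : ℕ → M.X), path n = z →
    (∀ k, k < n → 0 < M.P (path k) (path (k+1))) →
    (M.KB {z})^[n+1] (fun _ => 1) (path 0) < 1 := by
  induction n with
  | zero =>
    intro path h _
    simp [KB, h]
  | succ n ih =>
    intro path h hp
    rw [Function.iterate_succ_apply']
    unfold KB
    split_ifs with hz
    · exact zero_lt_one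
    · have h1 := ih (fun k => path (k+1)) h (fun k hk => hp (k+1) (by omega))
      have hone : ∀ y, (M.KB {z})^[n+1] (fun _ => 1) y ≤ 1 :=
        M.iter_le_const _ (fun _ => le_rfl) _
      have hlt : ∑' y, M.pe (path 0) y * (M.KB {z})^[n+1] (fun _ => 1) y
          < ∑' y, M.pe (path 0) y := by
        refine ENNReal.tsum_lt_tsum (i := path 1) ?_ ?_ ?_
        · refine ne_top_of_le_ne_top (b := 1) ENNReal.one_ne_top ?_
          exact (ENNReal.tsum_le_tsum fun y => mul_le_of_le_one_right' (hone y)).trans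
            (M.pe_sum (path 0)).le
        · intro y; exact mul_le_of_le_one_right' (hone y)
        · have hp0 : M.pe (path 0) (path 1) ≠ 0 := by
            simpa [pe] using hp 0 (by omega)
          calc _ < M.pe (path 0) (path 1) * 1 :=
                ENNReal.mul_lt_mul_right hp0 ENNReal.ofReal_ne_top h1
            _ = _ := mul_one _
      rwa [M.pe_sum] at hlt

lemma exists_theta (A : Set M.X) (hA : A.Finite) (z : M.X) :
    ∃ (n : ℕ) (θ : ℝ≥0∞), θ < 1 ∧ ∀ a ∈ A, (M.KB {z})^[n] (fun _ => 1) a ≤ θ := by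
  have hex : ∀ a : M.X, ∃ n, (M.KB {z})^[n] (fun _ => 1) a < 1 := by
    intro a
    obtain ⟨n, path, h0, hn, hp⟩ := M.irr a z
    refine ⟨n+1, ?_⟩
    rw [← h0]
    exact M.hit_pos z n path hn hp
  choose N hN using hex
  refine ⟨hA.toFinset.sup N, hA.toFinset.sup fun a => (M.KB {z})^[N a] (fun _ => 1) a, ?_, ?_⟩
  · rw [Finset.sup_lt_iff (by simp)]
    intro a _
    exact hN a
  · intro a ha
    have ha' : a ∈ hA.toFinset := by simpa using ha
    refine le_trans ?_ (Finset.le_sup (f := fun a => (M.KB {z})^[N a] (fun _ => 1) a) ha')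
    exact M.one_antitone {z} a (Finset.le_sup (f := N) ha')

lemma tsum_iInf_ge (x : M.X) (f : ℕ → M.X → ℝ≥0∞) (hf : Antitone f) (h1 : ∀ y, f 0 y ≤ 1) :
    ⨅ m, ∑' y, M.pe x y * f m y ≤ ∑' y, M.pe x y * ⨅ m, f m y := by
  let _ : MeasurableSpace M.X := ⊤
  have hm : ∀ g : M.X → ℝ≥0∞, Measurable g := fun g => measurable_from_top
  have h : ∫⁻ y, ⨅ m, M.pe x y * f m y ∂Measure.count
      = ⨅ m, ∫⁻ y, M.pe x y * f m y ∂Measure.count := by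
    refine lintegral_iInf (fun n => hm _) ?_ ?_
    · intro m n hmn y
      exact mul_le_mul_right (hf hmn y) _
    · rw [lintegral_count]
      refine ne_top_of_le_ne_top (b := 1) ENNReal.one_ne_top ?_
      rw [← M.pe_sum x]
      exact ENNReal.tsum_le_tsum fun y => mul_le_of_le_one_right' (h1 y)
  simp_rw [lintegral_count] at h
  rw [← h]
  refine le_of_eq (tsum_congr fun y => ?_)
  exact (ENNReal.mul_iInf fun h => absurd h ENNReal.ofReal_ne_top).symm

lemma hit_ae (A : Set M.X) (hAf : A.Finite) (z : M.X)
    (hA : ∀ x, Tendsto (fun j => (M.KB A)^[j] (fun _ => 1) x) atTop (nhds 0)) (x : M.X) :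
    ⨅ m, (M.KB {z})^[m] (fun _ => 1) x = 0 := by
  obtain ⟨n, θ, hθ1, hθ⟩ := M.exists_theta A hAf z
  have hanti : Antitone fun m => (M.KB {z})^[m] (fun _ => (1 : ℝ≥0∞)) :=
    fun m n h y => M.one_antitone {z} y h
  have hle1 : ∀ x, ⨅ m, (M.KB {z})^[m] (fun _ => 1) x ≤ 1 := fun x => iInf_le_of_le 0 (by simp)
  have := M.core A z (V := fun x => ⨅ m, (M.KB {z})^[m] (fun _ => 1) x) (w := fun _ => 0)
    (W := 0) (C := 0) (θ := θ) (n := n) ?_ ?_ (by simp) ?_ hA hθ hθ1 ?_ x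
  · simpa using this
  · intro x
    rw [zero_add]
    refine le_trans ?_ (M.tsum_iInf_ge x _ hanti (by simp))
    refine le_iInf fun m => iInf_le_of_le (m+1) ?_
    rw [Function.iterate_succ_apply']
    unfold KB
    split_ifs
    · exact zero_le
    · exact le_rfl
  · refine le_antisymm (iInf_le_of_le 1 ?_) (zero_le)
    simp [KB]
  · intro j x
    simpa using M.vv_le A (w := fun _ => 0) (W := 0) (by simp) j x
  · exact ne_top_of_le_ne_top ENNReal.one_ne_top (iSup_le hle1)

lemma green_bound (A : Set M.X) (hAf : A.Finite) (z : M.X) {C : ℝ≥0∞} (hCt : C ≠ ⊤)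
    (hC : ∀ j x, M.vv A M.we j x ≤ C)
    (hA : ∀ x, Tendsto (fun j => (M.KB A)^[j] (fun _ => 1) x) atTop (nhds 0)) :
    ∃ D : ℝ≥0∞, D ≠ ⊤ ∧ ∀ m x, M.vv {z} M.we m x ≤ D := by
  obtain ⟨n, θ, hθ1, hθ⟩ := M.exists_theta A hAf z
  obtain ⟨W, hWt, hW⟩ : ∃ W : ℝ≥0∞, W ≠ ⊤ ∧ ∀ x, M.we x ≤ W := by
    refine ⟨C + ∑ a ∈ hAf.toFinset, M.we a, ?_, ?_⟩
    · refine ENNReal.add_ne_top.2 ⟨hCt, ?_⟩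
      exact ENNReal.sum_ne_top.2 fun a _ => ENNReal.ofReal_ne_top
    · intro x
      by_cases hx : x ∈ A
      · refine le_add_left ?_
        exact Finset.single_le_sum (f := M.we) (fun _ _ => zero_le) (by simpa using hx)
      · refine le_add_right ?_
        have := hC 1 x
        simpa [vv, off, hx] using this
  refine ⟨(n * W + C) / (1 - θ), ?_, ?_⟩
  · refine ENNReal.div_ne_top ?_ (tsub_pos_of_lt hθ1).ne'
    exact ENNReal.add_ne_top.2 ⟨ENNReal.mul_ne_top (by simp) hWt, hCt⟩
  · intro m x
    refine M.core A z (V := M.vv {z} M.we m) ?_ ?_ hW hC hA hθ hθ1 ?_ x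
    · intro x
      refine (M.vv_mono {z} M.we x (Nat.le_succ m)).trans ?_
      show M.vv {z} M.we (m+1) x ≤ _
      rw [vv_succ]
      unfold off KB
      split_ifs
      · simp
      · exact le_rfl
    · cases m with
      | zero => simp [vv]
      | succ m => rw [vv_succ]; simp [off, KB]
    · refine ne_top_of_le_ne_top (b := m * W) (ENNReal.mul_ne_top (by simp) hWt) ?_
      exact iSup_le fun x => M.vv_le _ hW m x

/-! ### probabilistic part -/

/-- cylinder set -/
def Cyl (path : ℕ → M.X) (j : ℕ) : Set M.Ω := {ω | ∀ k, k ≤ j → M.jump k ω = path k}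

lemma Cyl_meas (path : ℕ → M.X) (j : ℕ) : MeasurableSet (M.Cyl path j) := by
  have : M.Cyl path j = ⋂ k, ⋂ (_ : k ≤ j), {ω | M.jump k ω = path k} := by
    ext ω; simp [Cyl]
  rw [this]
  exact MeasurableSet.iInter fun k => MeasurableSet.iInter fun _ => M.jump_meas k _

lemma Cyl_split (path : ℕ → M.X) (j : ℕ) :
    M.Cyl path j = ⋃ y, M.Cyl (Function.update path (j+1) y) (j+1) := by
  ext ω
  simp only [Cyl, mem_ofPred_eq, mem_iUnion]
  constructor
  · intro h
    refine ⟨M.jump (j+1) ω, fun k hk => ?_⟩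
    rcases eq_or_ne k (j+1) with rfl | hne
    · simp
    · rw [Function.update_of_ne hne]; exact h k (by omega)
  · rintro ⟨y, h⟩ k hk
    have := h k (by omega)
    rwa [Function.update_of_ne (by omega)] at this

lemma Cyl_disj (path : ℕ → M.X) (j : ℕ) :
    Pairwise (Function.onFun Disjoint fun y => M.Cyl (Function.update path (j+1) y) (j+1)) := by
  intro y y' h
  refine Set.disjoint_left.2 fun ω h1 h2 => h ?_
  have e1 := h1 (j+1) le_rfl
  have e2 := h2 (j+1) le_rfl
  simp only [Function.update_self] at e1 e2
  exact e1.symm.trans e2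

lemma lint_split (x : M.X) (path : ℕ → M.X) (j : ℕ) (F : M.Ω → ℝ≥0∞) :
    ∫⁻ ω in M.Cyl path j, F ω ∂M.μ x
      = ∑' y, ∫⁻ ω in M.Cyl (Function.update path (j+1) y) (j+1), F ω ∂M.μ x := by
  conv_lhs => rw [M.Cyl_split path j]
  rw [lintegral_iUnion (fun y => M.Cyl_meas _ _) (M.Cyl_disj path j)]

lemma law_P (x : M.X) (n : ℕ) (path : ℕ → M.X) (t : ℕ → ℝ) (h0 : path 0 = x)
    (ht : ∀ k, 0 ≤ t k) :
    M.μ x (M.Cyl path n ∩ {ω | ∀ k, k < n → t k < M.hold k ω})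
      = ENNReal.ofReal (∏ k ∈ Finset.range n,
          (M.P (path k) (path (k+1)) * Real.exp (-(M.γ (path k)) * t k))) :=
  M.law x n path t h0 ht

lemma Cyl_mu (x : M.X) (n : ℕ) (path : ℕ → M.X) (h0 : path 0 = x) :
    M.μ x (M.Cyl path n) = ENNReal.ofReal (∏ k ∈ Finset.range n, M.P (path k) (path (k+1))) := by
  have := M.law_P x n path (fun _ => 0) h0 (fun _ => le_rfl)
  have e : M.Cyl path n ∩ {ω | ∀ k, k < n → 0 < M.hold k ω} = M.Cyl path n :=
    Set.inter_eq_left.2 fun ω _ k _ => M.hold_pos k ω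
  rw [e] at this
  simpa using this

lemma Cyl_succ (x : M.X) (j : ℕ) (path : ℕ → M.X) (h0 : path 0 = x) (y : M.X) (s : ℝ)
    (hs : 0 ≤ s) :
    M.μ x (M.Cyl (Function.update path (j+1) y) (j+1) ∩ {ω | s < M.hold j ω})
      = M.μ x (M.Cyl path j) * M.pe (path j) y * ENNReal.ofReal (Real.exp (-(M.γ (path j)) * s)) := by
  have := M.law_P x (j+1) (Function.update path (j+1) y) (fun k => if k = j then s else 0)
    (by rw [Function.update_of_ne (by omega)]; exact h0)
    (fun k => by split_ifs <;> simp [hs])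
  have e : M.Cyl (Function.update path (j+1) y) (j+1) ∩
      {ω | ∀ k, k < j+1 → (fun k => if k = j then s else 0) k < M.hold k ω}
      = M.Cyl (Function.update path (j+1) y) (j+1) ∩ {ω | s < M.hold j ω} := by
    congr 1
    ext ω
    simp only [mem_ofPred_eq]
    constructor
    · intro h; simpa using h j (by omega)
    · intro h k _
      split_ifs with hk
      · rw [hk]; exact h
      · exact M.hold_pos k ω
  rw [e] at this
  rw [this, M.Cyl_mu x j path h0, Finset.prod_range_succ]
  have e2 : ∏ k ∈ Finset.range j, (M.P (Function.update path (j+1) y k)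
      (Function.update path (j+1) y (k+1)) *
      Real.exp (-(M.γ (Function.update path (j+1) y k)) * (if k = j then s else 0)))
      = ∏ k ∈ Finset.range j, M.P (path k) (path (k+1)) := by
    refine Finset.prod_congr rfl fun k hk => ?_
    have hk' := Finset.mem_range.1 hk
    rw [Function.update_of_ne (by omega), Function.update_of_ne (by omega), if_neg (by omega)]
    simp
  rw [e2, Function.update_of_ne (by omega), Function.update_self, if_pos rfl]
  rw [ENNReal.ofReal_mul (Finset.prod_nonneg fun k _ => M.P_nonneg _ _),
    ENNReal.ofReal_mul (M.P_nonneg _ _), mul_assoc]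
  rfl

lemma Cyl_step (x : M.X) (j : ℕ) (path : ℕ → M.X) (h0 : path 0 = x) (y : M.X) :
    M.μ x (M.Cyl (Function.update path (j+1) y) (j+1))
      = M.μ x (M.Cyl path j) * M.pe (path j) y := by
  have := M.Cyl_succ x j path h0 y 0 le_rfl
  have e : M.Cyl (Function.update path (j+1) y) (j+1) ∩ {ω | 0 < M.hold j ω}
    = M.Cyl (Function.update path (j+1) y) (j+1) := Set.inter_eq_left.2 fun ω _ => M.hold_pos j ω
  rw [e] at this
  simpa using this

lemma Cyl_hold (x : M.X) (j : ℕ) (path : ℕ → M.X) (h0 : path 0 = x) (s : ℝ) (hs : 0 ≤ s) :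
    M.μ x (M.Cyl path j ∩ {ω | s < M.hold j ω})
      = M.μ x (M.Cyl path j) * ENNReal.ofReal (Real.exp (-(M.γ (path j)) * s)) := by
  have hms : MeasurableSet {ω | s < M.hold j ω} := M.hold_meas j measurableSet_Ioi
  conv_lhs => rw [M.Cyl_split path j, iUnion_inter]
  rw [measure_iUnion]
  · simp_rw [M.Cyl_succ x j path h0 _ s hs]
    rw [ENNReal.tsum_mul_right, ENNReal.tsum_mul_left, M.pe_sum, mul_one]
  · intro y y' h
    exact (M.Cyl_disj path j h).mono inter_subset_left inter_subset_left
  · exact fun y => (M.Cyl_meas _ _).inter hms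

lemma lint_hold (x : M.X) (j : ℕ) (path : ℕ → M.X) (h0 : path 0 = x) :
    ∫⁻ ω in M.Cyl path j, ENNReal.ofReal (M.hold j ω) ∂M.μ x
      = M.μ x (M.Cyl path j) * M.we (path j) := by
  have hg := M.γ_pos (path j)
  rw [lintegral_eq_lintegral_meas_lt _ (Eventually.of_forall fun ω => (M.hold_pos j ω).le)
    (M.hold_meas j).aemeasurable]
  have : ∀ s ∈ Ioi (0:ℝ), (M.μ x).restrict (M.Cyl path j) {ω | s < M.hold j ω}
      = M.μ x (M.Cyl path j) * ENNReal.ofReal (Real.exp (-(M.γ (path j)) * s)) := by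
    intro s hs
    have hms : MeasurableSet {ω | s < M.hold j ω} := M.hold_meas j measurableSet_Ioi
    rw [Measure.restrict_apply hms, inter_comm]
    exact M.Cyl_hold x j path h0 s (le_of_lt hs)
  rw [setLIntegral_congr_fun measurableSet_Ioi this]
  rw [lintegral_const_mul _ (by fun_prop)]
  congr 1
  rw [← ofReal_integral_eq_lintegral_ofReal]
  · unfold we
    congr 1
    rw [integral_exp_mul_Ioi (by linarith)]
    simp
  · exact integrableOn_exp_mul_Ioi (by linarith) 0
  · exact Eventually.of_forall fun s => (Real.exp_pos _).le

/-- general iteration lemma -/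
lemma lint_iter (B : Set M.X) (x : M.X) (Ψ : ℕ → M.Ω → ℝ≥0∞) (g : M.X → ℝ≥0∞)
    (h : ∀ j path, path 0 = x →
      ∫⁻ ω in M.Cyl path j, Ψ j ω ∂M.μ x = M.μ x (M.Cyl path j) * g (path j)) (r : ℕ) :
    ∀ j path, path 0 = x →
      ∫⁻ ω in M.Cyl path j, (if ∀ i, j ≤ i → i < j + r → M.jump i ω ∉ B then Ψ (j+r) ω else 0)
        ∂M.μ x = M.μ x (M.Cyl path j) * (M.KB B)^[r] g (path j) := by
  induction r with
  | zero =>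
    intro j path h0
    rw [← show _ = M.μ x (M.Cyl path j) * (M.KB B)^[0] g (path j) from h j path h0]
    refine lintegral_congr fun ω => ?_
    rw [if_pos (fun i h1 h2 => absurd h2 (by omega))]
    rfl
  | succ r ih =>
    intro j path h0
    rw [Function.iterate_succ_apply']
    by_cases hB : path j ∈ B
    · simp only [KB, hB, if_true, mul_zero]
      rw [setLIntegral_congr_fun (g := fun _ => 0) (M.Cyl_meas _ _)]
      · simp
      · intro ω hω
        simp only
        rw [if_neg]
        intro hh
        apply hh j le_rfl (by omega)
        rw [hω j le_rfl]; exact hB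
    · simp only [KB, hB, if_false]
      rw [M.lint_split, ← ENNReal.tsum_mul_left]
      refine tsum_congr fun y => ?_
      have h0' : Function.update path (j+1) y 0 = x := by
        rw [Function.update_of_ne (by omega)]; exact h0
      have := ih (j+1) (Function.update path (j+1) y) h0'
      rw [M.Cyl_step x j path h0 y, Function.update_self] at this
      rw [← mul_assoc, ← this]
      refine setLIntegral_congr_fun (M.Cyl_meas _ _) fun ω hω => ?_
      have hj : M.jump j ω = path j := by
        rw [hω j (by omega), Function.update_of_ne (by omega)]
      have e : (∀ i, j ≤ i → i < j + (r+1) → M.jump i ω ∉ B) ↔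
          (∀ i, j+1 ≤ i → i < j + 1 + r → M.jump i ω ∉ B) := by
        constructor
        · intro hh i h1 h2; exact hh i (by omega) (by omega)
        · intro hh i h1 h2
          rcases eq_or_ne i j with rfl | hne
          · rw [hj]; exact hB
          · exact hh i (by omega) (by omega)
      have e3 : j + (r+1) = j + 1 + r := by omega
      simp only [e]
      rw [e3]

lemma lint_zero (x : M.X) (F : M.Ω → ℝ≥0∞) :
    ∫⁻ ω in M.Cyl (fun _ => x) 0, F ω ∂M.μ x = ∫⁻ ω, F ω ∂M.μ x := by
  have h1 : M.Cyl (fun _ => x) 0 = {ω | M.jump 0 ω = x} := by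
    ext ω; simp [Cyl]
  have : (M.μ x).restrict (M.Cyl (fun _ => x) 0) = M.μ x := by
    refine Measure.restrict_eq_self_of_ae_mem ?_
    rw [h1]
    exact (mem_ae_iff_prob_eq_one (M.jump_meas 0 x)).2 (M.start x)
  rw [this]

lemma avoid_meas (B : Set M.X) (m : ℕ) : MeasurableSet {ω | ∀ i, i < m → M.jump i ω ∉ B} := by
  have : {ω | ∀ i, i < m → M.jump i ω ∉ B}
      = ⋂ i, ⋂ (_ : i < m), (⋃ b ∈ B, {ω | M.jump i ω = b})ᶜ := by
    ext ω
    simp only [mem_ofPred_eq, mem_iInter, mem_compl_iff, mem_iUnion, exists_prop,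
      exists_eq_right']
  rw [this]
  refine MeasurableSet.iInter fun k => MeasurableSet.iInter fun _ => MeasurableSet.compl ?_
  exact MeasurableSet.biUnion (Set.to_countable B) fun b _ => M.jump_meas k b

lemma avoid_mu (B : Set M.X) (x : M.X) (m : ℕ) :
    M.μ x {ω | ∀ i, i < m → M.jump i ω ∉ B} = (M.KB B)^[m] (fun _ => 1) x := by
  have := M.lint_iter B x (fun _ _ => 1) (fun _ => 1) (by intro j path _; simp) m 0
    (fun _ => x) rfl
  rw [M.lint_zero] at this
  have hC : M.μ x (M.Cyl (fun _ => x) 0) = 1 := by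
    rw [M.Cyl_mu x 0 _ rfl]; simp
  rw [hC, one_mul] at this
  rw [← this, ← lintegral_indicator_one (M.avoid_meas B m)]
  refine lintegral_congr fun ω => ?_
  simp [Set.indicator_apply]

/-- truncated passage time -/
noncomputable def TT (B : Set M.X) (m : ℕ) (ω : M.Ω) : ℝ≥0∞ :=
  ∑ k ∈ Finset.range m,
    if ∀ i, i < k + 1 → M.jump i ω ∉ B then ENNReal.ofReal (M.hold k ω) else 0

lemma TT_term_meas (B : Set M.X) (k : ℕ) : Measurable fun ω =>
    if ∀ i, i < k + 1 → M.jump i ω ∉ B then ENNReal.ofReal (M.hold k ω) else 0 :=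
  Measurable.ite (M.avoid_meas B (k+1)) (M.hold_meas k).ennreal_ofReal measurable_const

lemma TT_meas (B : Set M.X) (m : ℕ) : Measurable (M.TT B m) :=
  Finset.measurable_fun_sum _ fun k _ => M.TT_term_meas B k

lemma TT_lint (B : Set M.X) (m : ℕ) (x : M.X) :
    ∫⁻ ω, M.TT B m ω ∂M.μ x = M.vv B M.we m x := by
  unfold TT vv
  rw [lintegral_finsetSum _ fun k _ => M.TT_term_meas B k]
  refine Finset.sum_congr rfl fun k _ => ?_
  have := M.lint_iter B x
    (fun j ω => if M.jump j ω ∈ B then 0 else ENNReal.ofReal (M.hold j ω)) (M.off B M.we) ?_ k 0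
    (fun _ => x) rfl
  · rw [M.lint_zero] at this
    have hC : M.μ x (M.Cyl (fun _ => x) 0) = 1 := by
      rw [M.Cyl_mu x 0 _ rfl]; simp
    rw [hC, one_mul] at this
    rw [← this]
    refine lintegral_congr fun ω => ?_
    simp only [zero_add, zero_le, true_implies]
    by_cases h1 : ∀ i, i < k → M.jump i ω ∉ B
    · rw [if_pos h1]
      by_cases h2 : M.jump k ω ∈ B
      · rw [if_pos h2, if_neg]
        intro h; exact h k (by omega) h2
      · rw [if_neg h2, if_pos]
        intro i hi
        rcases eq_or_ne i k with rfl | hne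
        · exact h2
        · exact h1 i (by omega)
    · rw [if_neg h1, if_neg]
      intro h; exact h1 fun i hi => h i (by omega)
  · intro j path h0
    unfold off
    by_cases hB : path j ∈ B
    · rw [setLIntegral_congr_fun (g := fun _ => 0) (M.Cyl_meas _ _)]
      · simp [hB]
      · intro ω hω
        simp [hω j le_rfl, hB]
    · rw [if_neg hB, ← M.lint_hold x j path h0]
      refine setLIntegral_congr_fun (M.Cyl_meas _ _) fun ω hω => ?_
      simp [hω j le_rfl, hB]

lemma J_mono (ω : M.Ω) : Monotone fun n => M.J n ω :=
  monotone_nat_of_le_succ fun n => by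
    unfold J; rw [Finset.sum_range_succ]; linarith [M.hold_pos n ω]

lemma J_lt (n : ℕ) (ω : M.Ω) : M.J n ω < M.J (n+1) ω := by
  unfold J; rw [Finset.sum_range_succ]; linarith [M.hold_pos n ω]

lemma J_nonneg (n : ℕ) (ω : M.Ω) : 0 ≤ M.J n ω :=
  Finset.sum_nonneg fun k _ => (M.hold_pos k ω).le

lemma pos_J (n : ℕ) (ω : M.Ω) : M.pos (M.J n ω) ω = some (M.jump n ω) := by
  have h : ∃ k, M.J k ω ≤ M.J n ω ∧ M.J n ω < M.J (k+1) ω := ⟨n, le_rfl, M.J_lt n ω⟩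
  unfold pos
  rw [dif_pos h]
  have hc := h.choose_spec
  have : h.choose = n := by
    rcases lt_trichotomy h.choose n with hl | he | hg
    · exact absurd (M.J_mono ω (show h.choose + 1 ≤ n by omega)) (not_le.2 hc.2)
    · exact he
    · have := M.J_mono ω (show n + 1 ≤ h.choose by omega)
      simp only at this
      linarith [M.J_lt n ω, hc.1]
  rw [this]

lemma pos_some {t : ℝ} {ω : M.Ω} {a : M.X} (h : M.pos t ω = some a) :
    ∃ n, M.J n ω ≤ t ∧ M.jump n ω = a := by
  unfold pos at h
  split_ifs at h with hh
  exact ⟨hh.choose, hh.choose_spec.1, Option.some.inj h⟩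

lemma ofReal_J (n : ℕ) (ω : M.Ω) :
    ENNReal.ofReal (M.J n ω) = ∑ k ∈ Finset.range n, ENNReal.ofReal (M.hold k ω) :=
  ENNReal.ofReal_sum_of_nonneg fun k _ => (M.hold_pos k ω).le

lemma TT_le_tau (B : Set M.X) (m : ℕ) (ω : M.Ω) : M.TT B m ω ≤ M.tau B ω := by
  refine le_sInf ?_
  rintro _ ⟨s, ⟨_, a, ha, hpos⟩, rfl⟩
  obtain ⟨n, hn, hj⟩ := M.pos_some hpos
  refine le_trans ?_ (ENNReal.ofReal_le_ofReal hn)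
  rw [ofReal_J]
  unfold TT
  rw [← Finset.sum_filter]
  refine Finset.sum_le_sum_of_subset ?_
  intro k hk
  rw [Finset.mem_filter] at hk
  rw [Finset.mem_range]
  by_contra hcon
  exact hk.2 n (by omega) (hj ▸ ha)

lemma tau_top (B : Set M.X) (ω : M.Ω) (h : ∀ i, M.jump i ω ∉ B) : M.tau B ω = ⊤ := by
  unfold tau
  rw [sInf_eq_top]
  rintro _ ⟨s, ⟨_, a, ha, hpos⟩, rfl⟩
  obtain ⟨n, hn, hj⟩ := M.pos_some hpos
  exact absurd (hj ▸ ha) (h n)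

lemma tau_le (B : Set M.X) (ω : M.Ω) (h : ∃ i, M.jump i ω ∈ B) :
    M.tau B ω ≤ ⨆ m, M.TT B m ω := by
  refine le_trans ?_ (le_iSup _ (Nat.find h))
  have hs := Nat.find_spec h
  have : M.tau B ω ≤ ENNReal.ofReal (M.J (Nat.find h) ω) :=
    sInf_le ⟨_, ⟨M.J_nonneg _ ω, _, hs, M.pos_J _ ω⟩, rfl⟩
  refine this.trans (le_of_eq ?_)
  rw [ofReal_J]
  unfold TT
  refine Finset.sum_congr rfl fun k hk => ?_
  rw [if_pos]
  intro i hi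
  have := Finset.mem_range.1 hk
  exact Nat.find_min h (by omega)

end CTMC

open CTMC in
/-- Proposition: if the (embedded) chain is recurrent and `E_x τ_A ≤ C`
uniformly in `x` for some finite set `A`, then the chain implodes towards
every single state `z`. -/
theorem statement19 (M : CTMC) (hrec : M.JumpRecurrent)
    (A : Set M.X) (hA : A.Finite) (C : ℝ) (hC : 0 < C)
    (hbound : ∀ x : M.X, ∫⁻ ω, M.tau A ω ∂ M.μ x ≤ ENNReal.ofReal C) :
    ∀ z : M.X, ∃ C' : ℝ, 0 < C' ∧ ∀ x : M.X,
      ∫⁻ ω, M.tau {z} ω ∂ M.μ x ≤ ENNReal.ofReal C' := by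
  intro z
  have hvA : ∀ j x, M.vv A M.we j x ≤ ENNReal.ofReal C := by
    intro j x
    rw [← M.TT_lint]
    exact (lintegral_mono fun ω => M.TT_le_tau A j ω).trans (hbound x)
  have hanti : ∀ B : Set M.X, Antitone fun m => {ω | ∀ i, i < m → M.jump i ω ∉ B} :=
    fun B m n hmn ω h i hi => h i (by omega)
  have hset : ∀ B : Set M.X, ⋂ m, {ω | ∀ i, i < m → M.jump i ω ∉ B}
      = {ω | ∀ i, M.jump i ω ∉ B} := by
    intro B
    ext ω
    simp only [mem_iInter, mem_ofPred_eq]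
    exact ⟨fun h i => h (i+1) i (by omega), fun h _ i _ => h i⟩
  have hlim : ∀ (B : Set M.X) x, Tendsto (fun j => (M.KB B)^[j] (fun _ => 1) x) atTop
      (nhds (M.μ x {ω | ∀ i, M.jump i ω ∉ B})) := by
    intro B x
    rw [← hset B]
    simp_rw [← M.avoid_mu B x]
    exact tendsto_measure_iInter_atTop (fun m => (M.avoid_meas B m).nullMeasurableSet)
      (hanti B) ⟨0, measure_ne_top _ _⟩
  have hA0 : ∀ x, M.μ x {ω | ∀ i, M.jump i ω ∉ A} = 0 := by
    intro x
    have hm : MeasurableSet {ω | ∀ i, M.jump i ω ∉ A} := by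
      rw [← hset A]; exact MeasurableSet.iInter fun m => M.avoid_meas A m
    by_contra hne
    have h1 : ∫⁻ ω in {ω | ∀ i, M.jump i ω ∉ A}, ⊤ ∂M.μ x ≤ ∫⁻ ω, M.tau A ω ∂M.μ x := by
      refine le_trans (le_of_eq ?_) (setLIntegral_le_lintegral {ω | ∀ i, M.jump i ω ∉ A} _)
      exact setLIntegral_congr_fun hm fun ω hω => (M.tau_top A ω hω).symm
    rw [setLIntegral_const, ENNReal.top_mul hne] at h1
    exact absurd (h1.trans (hbound x)) (by simp)
  have hA' : ∀ x, Tendsto (fun j => (M.KB A)^[j] (fun _ => 1) x) atTop (nhds 0) := by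
    intro x
    have := hlim A x
    rwa [hA0 x] at this
  obtain ⟨D, hDt, hD⟩ := M.green_bound A hA z ENNReal.ofReal_ne_top hvA hA'
  refine ⟨D.toReal + 1, by positivity, fun x => ?_⟩
  have hz0 : M.μ x {ω | ∀ i, M.jump i ω ∉ ({z} : Set M.X)} = 0 := by
    rw [← M.hit_ae A hA z hA' x]
    exact tendsto_nhds_unique (hlim {z} x) (tendsto_atTop_iInf (M.one_antitone {z} x))
  have hae : ∀ᵐ ω ∂M.μ x, M.tau {z} ω ≤ ⨆ m, M.TT {z} m ω := by
    have : ∀ᵐ ω ∂M.μ x, ¬ ∀ i, M.jump i ω ∉ ({z} : Set M.X) := by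
      rw [ae_iff]; simpa using hz0
    filter_upwards [this] with ω hω
    push Not at hω
    exact M.tau_le {z} ω hω
  calc ∫⁻ ω, M.tau {z} ω ∂M.μ x ≤ ∫⁻ ω, ⨆ m, M.TT {z} m ω ∂M.μ x := lintegral_mono_ae hae
    _ = ⨆ m, ∫⁻ ω, M.TT {z} m ω ∂M.μ x :=
        lintegral_iSup (fun m => M.TT_meas {z} m) fun m n hmn ω =>
          Finset.sum_le_sum_of_subset (Finset.range_mono hmn)
    _ ≤ D := iSup_le fun m => by rw [M.TT_lint]; exact hD m x
    _ = ENNReal.ofReal D.toReal := (ENNReal.ofReal_toReal hDt).symm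
    _ ≤ ENNReal.ofReal (D.toReal + 1) := ENNReal.ofReal_le_ofReal (by linarith)
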